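/- Suppose D and D' are given by families of permutations (as permutation matrices) M⁽μ⁾ and N⁽μ⁾ of {1,…,N}, μ ∈ {1,…,r}, such that for every word γ = (γ₁,…,γₘ) over {1,…,r}, Tr(M⁽γₘ⁾···M⁽γ₁⁾) = Tr(N⁽γₘ⁾···N⁽γ₁⁾). Then there exists an invertible complex N×N matrix T satisfying T·M⁽μ⁾ = N⁽μ⁾·T for all μ. -/

import Mathlib

open MonoidAlgebra in
/-- trace character of a module over the group algebra -/
noncomputable def chr (G V : Type) [Group G] [AddCommGroup V] [Module ℂ V]
    [Module (MonoidAlgebra ℂ G) V] [IsScalarTower ℂ (MonoidAlgebra ℂ G) V] (g : G) : ℂ :=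
  (Representation.ofModule' (k := ℂ) (G := G) V).character g

theorem ofModule'_app (G V : Type) [Group G] [AddCommGroup V] [Module ℂ V]
    [Module (MonoidAlgebra ℂ G) V] [IsScalarTower ℂ (MonoidAlgebra ℂ G) V] (g : G) (v : V) :
    Representation.ofModule' (k := ℂ) (G := G) V g v = MonoidAlgebra.of ℂ G g • v := rfl

theorem chr_congr {G V W : Type} [Group G] [AddCommGroup V] [Module ℂ V]
    [Module (MonoidAlgebra ℂ G) V] [IsScalarTower ℂ (MonoidAlgebra ℂ G) V]
    [AddCommGroup W] [Module ℂ W]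
    [Module (MonoidAlgebra ℂ G) W] [IsScalarTower ℂ (MonoidAlgebra ℂ G) W]
    (e : V ≃ₗ[MonoidAlgebra ℂ G] W) (g : G) : chr G V g = chr G W g := by
  unfold chr Representation.character
  rw [← LinearMap.trace_conj' _ (e.restrictScalars ℂ)]
  congr 1
  ext w
  simp [LinearEquiv.conj_apply, ofModule'_app]

theorem chr_prod {G V W : Type} [Group G] [AddCommGroup V] [Module ℂ V]
    [Module (MonoidAlgebra ℂ G) V] [IsScalarTower ℂ (MonoidAlgebra ℂ G) V]
    [AddCommGroup W] [Module ℂ W]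
    [Module (MonoidAlgebra ℂ G) W] [IsScalarTower ℂ (MonoidAlgebra ℂ G) W]
    [FiniteDimensional ℂ V] [FiniteDimensional ℂ W]
    (g : G) : chr G (V × W) g = chr G V g + chr G W g := by
  unfold chr Representation.character
  rw [← LinearMap.trace_prodMap']
  congr 1

theorem equiv_of_chr {G : Type} [Group G] [Finite G] (d : ℕ) : ∀ (V W : Type)
    [AddCommGroup V] [Module ℂ V]
    [Module (MonoidAlgebra ℂ G) V] [IsScalarTower ℂ (MonoidAlgebra ℂ G) V]
    [AddCommGroup W] [Module ℂ W]
    [Module (MonoidAlgebra ℂ G) W] [IsScalarTower ℂ (MonoidAlgebra ℂ G) W]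
    [FiniteDimensional ℂ V] [FiniteDimensional ℂ W],
    Module.finrank ℂ V = d → (∀ g : G, chr G V g = chr G W g) →
    Nonempty (V ≃ₗ[MonoidAlgebra ℂ G] W) := by
  induction d using Nat.strong_induction_on with
  | _ d ih =>
  intro V W _ _ _ _ _ _ _ _ _ _ hd h
  have hrk : Module.finrank ℂ V = Module.finrank ℂ W := by
    have := h 1
    simp only [chr, Representation.char_one] at this
    exact_mod_cast this
  rcases subsingleton_or_nontrivial V with hV | hV
  · have : Subsingleton W := by
      rw [← Module.finrank_zero_iff (R := ℂ), ← hrk, Module.finrank_zero_iff]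
      exact hV
    exact ⟨⟨0, 0, fun _ => Subsingleton.elim _ _, fun _ => Subsingleton.elim _ _⟩⟩
  have hG : (Nat.card G : ℂ) ≠ 0 := by exact_mod_cast Nat.card_pos.ne'
  have hne : NeZero (Nat.card G : ℂ) := ⟨hG⟩
  obtain ⟨f, hf⟩ : ∃ f : V →ₗ[MonoidAlgebra ℂ G] W, f ≠ 0 := by
    have := Fintype.ofFinite G
    have : Invertible (Nat.card G : ℂ) := invertibleOfNonzero hG
    let ρ := Representation.ofModule' (k := ℂ) (G := G) V
    let σ := Representation.ofModule' (k := ℂ) (G := G) W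
    have h1 := Representation.card_inv_mul_sum_char_mul_char_eq_finrank ρ σ
    have h2 := Representation.card_inv_mul_sum_char_mul_char_eq_finrank ρ ρ
    have h3 : (Module.finrank ℂ (ρ.IntertwiningMap σ) : ℂ)
        = Module.finrank ℂ (ρ.IntertwiningMap ρ) := by
      rw [← h1, ← h2]
      congr 1
      refine Finset.sum_congr rfl fun g _ => ?_
      congr 1
      exact (h g).symm
    have h4 : Module.finrank ℂ (ρ.IntertwiningMap σ)
        = Module.finrank ℂ (ρ.IntertwiningMap ρ) := by exact_mod_cast h3
    have h5 : Module.finrank ℂ (ρ.IntertwiningMap ρ) ≠ 0 := by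
      have e1 := (Representation.invariantsEquivIntertwiningMap ρ ρ)
      have : Module.Finite ℂ (ρ.IntertwiningMap ρ) := Module.Finite.equiv e1
      intro h0
      rw [Module.finrank_zero_iff] at h0
      obtain ⟨v, hv⟩ := exists_ne (0 : V)
      have := DFunLike.congr_fun (h0.elim (Representation.IntertwiningMap.id ρ) 0) v
      exact hv this
    rw [← h4] at h5
    have : Nontrivial (ρ.IntertwiningMap σ) := Module.nontrivial_of_finrank_pos (R := ℂ) (Nat.pos_of_ne_zero h5)
    obtain ⟨f, hf⟩ := exists_ne (0 : ρ.IntertwiningMap σ)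
    refine ⟨MonoidAlgebra.equivariantOfLinearOfComm f.toLinearMap ?_, ?_⟩
    · intro g v
      exact Representation.IntertwiningMap.isIntertwining ρ σ f g v
    · intro h0
      apply hf
      ext v
      exact DFunLike.congr_fun h0 v
  obtain ⟨V1, hV1⟩ := MonoidAlgebra.Submodule.exists_isCompl (LinearMap.ker f)
  obtain ⟨W1, hW1⟩ := MonoidAlgebra.Submodule.exists_isCompl (LinearMap.range f)
  have : FiniteDimensional ℂ V1 := inferInstanceAs (FiniteDimensional ℂ (V1.restrictScalars ℂ))
  have : FiniteDimensional ℂ W1 := inferInstanceAs (FiniteDimensional ℂ (W1.restrictScalars ℂ))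
  have : FiniteDimensional ℂ (LinearMap.ker f) :=
    inferInstanceAs (FiniteDimensional ℂ ((LinearMap.ker f).restrictScalars ℂ))
  have : FiniteDimensional ℂ (LinearMap.range f) :=
    inferInstanceAs (FiniteDimensional ℂ ((LinearMap.range f).restrictScalars ℂ))
  let eV := Submodule.prodEquivOfIsCompl _ _ hV1
  let eW := Submodule.prodEquivOfIsCompl _ _ hW1
  let e1 : V1 ≃ₗ[MonoidAlgebra ℂ G] LinearMap.range f :=
    (Submodule.quotientEquivOfIsCompl _ _ hV1).symm.trans f.quotKerEquivRange
  have hlt : Module.finrank ℂ (LinearMap.ker f) < d := by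
    rw [← hd]
    refine Submodule.finrank_lt (s := (LinearMap.ker f).restrictScalars ℂ) ?_
    intro h0
    apply hf
    ext v
    have : v ∈ (LinearMap.ker f).restrictScalars ℂ := by rw [h0]; trivial
    exact this
  obtain ⟨e2⟩ := ih _ hlt (LinearMap.ker f) W1 rfl (by
    intro g
    have a1 := chr_congr eV g
    have a2 := chr_congr eW g
    have a3 := chr_congr e1 g
    rw [chr_prod] at a1 a2
    have := h g
    linear_combination a1 - a2 - a3 + this)
  exact ⟨eV.symm.trans (((e2.prodCongr e1).trans (LinearEquiv.prodComm _ _ _)).trans eW)⟩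

/-- permutation matrix -/
def pmat {n : ℕ} (s : Equiv.Perm (Fin n)) : Matrix (Fin n) (Fin n) ℂ :=
  Matrix.of fun i j => if s j = i then 1 else 0

/-- permutation matrices as a monoid hom -/
def pmatHom (n : ℕ) : Equiv.Perm (Fin n) →* Matrix (Fin n) (Fin n) ℂ where
  toFun := pmat
  map_one' := by
    ext i j
    simp [pmat, Matrix.one_apply, eq_comm]
  map_mul' s t := by
    ext i j
    simp [pmat, Matrix.mul_apply]
    congr

theorem matrix_version {G : Type} [Group G] [Finite G] (n : ℕ)
    (A B : G →* Matrix (Fin n) (Fin n) ℂ) (h : ∀ g, (A g).trace = (B g).trace) :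
    ∃ T : Matrix (Fin n) (Fin n) ℂ, IsUnit T ∧ ∀ g, T * A g = B g * T := by
  let L : Matrix (Fin n) (Fin n) ℂ →* ((Fin n → ℂ) →ₗ[ℂ] (Fin n → ℂ)) :=
    (Matrix.toLinAlgEquiv' (R := ℂ) (n := Fin n)).toAlgHom.toMonoidHom
  let ρ : Representation ℂ G (Fin n → ℂ) := L.comp A
  let σ : Representation ℂ G (Fin n → ℂ) := L.comp B
  have key : ∀ C : G →* Matrix (Fin n) (Fin n) ℂ, ∀ g : G,
      chr G (Representation.asModule (L.comp C : Representation ℂ G (Fin n → ℂ))) g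
        = (C g).trace := by
    intro C g
    have e : Representation.ofModule' (k := ℂ) (G := G)
        (Representation.asModule (L.comp C : Representation ℂ G (Fin n → ℂ))) g
        = Matrix.toLin' (C g) := by
      ext v : 1
      rw [ofModule'_app]
      have := Representation.single_smul
        (ρ := (L.comp C : Representation ℂ G (Fin n → ℂ))) (1 : ℂ) g v
      rw [one_smul] at this
      exact this
    unfold chr Representation.character
    rw [e]
    exact Matrix.trace_toLin'_eq _
  obtain ⟨e⟩ := equiv_of_chr _ ρ.asModule σ.asModule rfl (fun g => by
    rw [key A g, key B g, h g])
  let E : (Fin n → ℂ) ≃ₗ[ℂ] (Fin n → ℂ) :=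
    (ρ.asModuleEquiv.symm.trans (e.restrictScalars ℂ)).trans σ.asModuleEquiv
  refine ⟨LinearMap.toMatrix' E.toLinearMap, ?_, ?_⟩
  · rw [Matrix.isUnit_iff_isUnit_det, LinearMap.det_toMatrix']
    exact E.isUnit_det'
  · intro g
    apply Matrix.toLin'.injective
    rw [Matrix.toLin'_mul, Matrix.toLin'_mul, Matrix.toLin'_toMatrix']
    apply LinearMap.ext
    intro v
    have h1 : ρ.asModuleEquiv.symm (ρ g v) = _ := Representation.asModuleEquiv_symm_map_rho ρ g v
    change σ.asModuleEquiv (e (ρ.asModuleEquiv.symm (ρ g v))) = σ g (σ.asModuleEquiv (e (ρ.asModuleEquiv.symm v)))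
    rw [h1, map_smul, Representation.asModuleEquiv_map_smul]
    simp

/-- If two families of permutation matrices have equal traces on all words, then
they are intertwined by an invertible matrix (transplantability). -/
theorem stmt_3 (r n : ℕ) (σ τ : Fin r → Equiv.Perm (Fin n))
    (M N : Fin r → Matrix (Fin n) (Fin n) ℂ)
    (hM : ∀ μ, M μ = Matrix.of fun i j => if σ μ j = i then 1 else 0)
    (hN : ∀ μ, N μ = Matrix.of fun i j => if τ μ j = i then 1 else 0)
    (htr : ∀ m : ℕ, ∀ a : Fin m → Fin r,
      ((List.ofFn fun i => M (a i)).reverse.prod).trace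
        = ((List.ofFn fun i => N (a i)).reverse.prod).trace) :
    ∃ T : Matrix (Fin n) (Fin n) ℂ, IsUnit T ∧ ∀ μ, T * M μ = N μ * T := by
  have htr' : ∀ l : List (Fin r), (l.map M).prod.trace = (l.map N).prod.trace := by
    intro l
    have := htr l.reverse.length l.reverse.get
    have e : ∀ F : Fin r → Matrix (Fin n) (Fin n) ℂ,
        (List.ofFn fun i => F (l.reverse.get i)) = l.reverse.map F := by
      intro F
      rw [← List.ofFn_get l.reverse, List.map_ofFn]
      simp [Function.comp_def]
    rw [e, e] at this
    simpa using this
  let s : Fin r → Equiv.Perm (Fin n) × Equiv.Perm (Fin n) := fun μ => (σ μ, τ μ)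
  let G := Subgroup.closure (Set.range s)
  let A : G →* Matrix (Fin n) (Fin n) ℂ :=
    (pmatHom n).comp ((MonoidHom.fst _ _).comp G.subtype)
  let B : G →* Matrix (Fin n) (Fin n) ℂ :=
    (pmatHom n).comp ((MonoidHom.snd _ _).comp G.subtype)
  obtain ⟨T, hT, h⟩ := matrix_version n A B (by
    rintro ⟨g, hg⟩
    have hg' : g ∈ Submonoid.closure (Set.range s) := by
      rw [← Subgroup.closure_toSubmonoid_of_finite]; exact hg
    change (pmatHom n g.1).trace = (pmatHom n g.2).trace
    have : ∃ l : List (Fin r), pmatHom n g.1 = (l.map M).prod ∧ pmatHom n g.2 = (l.map N).prod := by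
      clear hg
      induction hg' using Submonoid.closure_induction with
      | mem x hx =>
        obtain ⟨μ, rfl⟩ := hx
        exact ⟨[μ], by simp [hM, s, pmatHom, pmat], by simp [hN, s, pmatHom, pmat]⟩
      | one => exact ⟨[], by simp, by simp⟩
      | mul x y _ _ hx hy =>
        obtain ⟨l, h1, h2⟩ := hx
        obtain ⟨l', h1', h2'⟩ := hy
        exact ⟨l ++ l', by simp [h1, h1'], by simp [h2, h2']⟩
    obtain ⟨l, h1, h2⟩ := this
    rw [h1, h2, htr'])
  refine ⟨T, hT, fun μ => ?_⟩
  have := h ⟨s μ, Subgroup.subset_closure ⟨μ, rfl⟩⟩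
  rw [hM, hN]
  exact this
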